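/- Let K₀, h₀ ∈ ℝ. The problem −Δv = 2K₀ e^v in 𝔻 with ∂v/∂ν + 2 = 2h₀ e^{v/2} on ∂𝔻 admits a solution if and only if either K₀ > 0, or K₀ ≤ 0 and h₀ > √(−K₀). In that case, all solutions are exactly the functions v_a(z) := 2 log( 2φ₀(1−|a|²) / ( φ₀² |1 − ā z|² + K₀ |z − a|² ) ) for a ∈ 𝔻, where φ₀ := h₀ + √(h₀² + K₀). -/

import Mathlib

open MeasureTheory Filter

noncomputable section

/-- The open unit disk in ℝ² ≅ ℂ. -/
def unitDisk : Set ℂ := Metric.ball 0 1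

/-- The closed unit disk. -/
def unitClosedDisk : Set ℂ := Metric.closedBall 0 1

/-- The unit circle ∂𝔻. -/
def unitCircle : Set ℂ := Metric.sphere 0 1

/-- Arc-length measure: the 1-dimensional Hausdorff measure on ℂ. -/
def arcMeasure : Measure ℂ := μH[1]

/-- Directional derivative of `u` at `z` in direction `v`. -/
def dirDeriv (v : ℂ) (u : ℂ → ℝ) (z : ℂ) : ℝ := fderiv ℝ u z v

/-- Euclidean gradient of `u` at `z`, realized as a complex number. -/
def grad (u : ℂ → ℝ) (z : ℂ) : ℂ := ⟨dirDeriv 1 u z, dirDeriv Complex.I u z⟩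

/-- Euclidean Laplacian. -/
def lap (u : ℂ → ℝ) (z : ℂ) : ℝ :=
  dirDeriv 1 (dirDeriv 1 u) z + dirDeriv Complex.I (dirDeriv Complex.I u) z

/-- Outward normal derivative on the unit circle: ν(z) = z. -/
def normalDeriv (u : ℂ → ℝ) (z : ℂ) : ℝ := fderiv ℝ u z z

/-- Tangential derivative on the unit circle: τ(z) = iz. -/
def tangentialDeriv (u : ℂ → ℝ) (z : ℂ) : ℝ := fderiv ℝ u z (Complex.I * z)

/-- Euclidean dot product on ℂ ≅ ℝ². -/
def dot (z w : ℂ) : ℝ := z.re * w.re + z.im * w.im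

/-- `u` solves `-Δu = 2K e^u` in 𝔻, `∂u/∂ν + 2 = 2h e^{u/2}` on ∂𝔻. -/
def SolvesLiouville (K h u : ℂ → ℝ) : Prop :=
  (∀ z ∈ unitDisk, -lap u z = 2 * K z * Real.exp (u z)) ∧
  (∀ z ∈ unitCircle, normalDeriv u z + 2 = 2 * h z * Real.exp (u z / 2))

/-- Convergence in C² on a set: uniform convergence of the derivatives up to order 2. -/
def TendstoC2On (F : ℕ → ℂ → ℝ) (G : ℂ → ℝ) (s : Set ℂ) : Prop :=
  ∀ i : ℕ, i ≤ 2 →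
    TendstoUniformlyOn (fun n => iteratedFDeriv ℝ i (F n)) (iteratedFDeriv ℝ i G)
      Filter.atTop s

/-- `sup u_n → +∞` on the closed disk. -/
def BlowsUp (u : ℕ → ℂ → ℝ) : Prop :=
  ∀ M : ℝ, ∀ᶠ n in Filter.atTop, ∃ z ∈ unitClosedDisk, M < u n z

/-- `u_n → -∞` locally uniformly on `s`. -/
def TendstoLocallyUniformlyBotOn (u : ℕ → ℂ → ℝ) (s : Set ℂ) : Prop :=
  ∀ (M : ℝ) (S : Set ℂ), IsCompact S → S ⊆ s →
    ∀ᶠ n in Filter.atTop, ∀ z ∈ S, u n z < M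

/-- Bounded total mass: area plus boundary length. -/
def MassBound (u : ℕ → ℂ → ℝ) (C : ℝ) : Prop :=
  ∀ n, (∫ z in unitDisk, Real.exp (u n z)) +
       (∫ z in unitCircle, Real.exp (u n z / 2) ∂arcMeasure) ≤ C

/-- `v` solves the constant-curvature problem `-Δv = 2K₀ e^v` in 𝔻,
`∂v/∂ν + 2 = 2h₀ e^{v/2}` on ∂𝔻. -/
def SolvesLiouvilleConst (K₀ h₀ : ℝ) (v : ℂ → ℝ) : Prop :=
  (∀ z ∈ unitDisk, -lap v z = 2 * K₀ * Real.exp (v z)) ∧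
  (∀ z ∈ unitCircle, normalDeriv v z + 2 = 2 * h₀ * Real.exp (v z / 2))

/-- The bubble `v_a(z) = 2 log( 2φ₀(1-|a|²) / (φ₀²|1-āz|² + K₀|z-a|²) )`. -/
def vBubble (K₀ φ₀ : ℝ) (a z : ℂ) : ℝ :=
  2 * Real.log ((2 * φ₀ * (1 - ‖a‖ ^ 2)) /
    (φ₀ ^ 2 * ‖1 - star a * z‖ ^ 2 + K₀ * ‖z - a‖ ^ 2))


lemma isConservativeOn_of_potential {U : Set ℂ} {p F G H : ℂ → ℂ}
    (hp : ContDiff ℝ 1 p) (hF : ContDiff ℝ 1 F) (hG : ContDiff ℝ 1 G)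
    (h1 : ∀ z ∈ U, H z = fderiv ℝ p z 1 + G z)
    (hI : ∀ z ∈ U, Complex.I * H z = fderiv ℝ p z Complex.I + F z)
    (hFG : ∀ z ∈ U, fderiv ℝ F z 1 = fderiv ℝ G z Complex.I) :
    Complex.IsConservativeOn H U := by
  intro z w hzw
  rw [← add_eq_zero_iff_eq_neg, Complex.wedgeIntegral_add_wedgeIntegral_eq]
  have hmem : ∀ x ∈ Set.uIcc z.re w.re, ∀ y ∈ Set.uIcc z.im w.im,
      (x : ℂ) + y * Complex.I ∈ U := fun x hx y hy => hzw (by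
    simp only [Complex.Rectangle, Complex.mem_reProdIm]
    simpa using ⟨hx, hy⟩)
  have hpd : Differentiable ℝ p := hp.differentiable one_ne_zero
  have hFd : Differentiable ℝ F := hF.differentiable one_ne_zero
  have hGd : Differentiable ℝ G := hG.differentiable one_ne_zero
  have hp' : Continuous (fderiv ℝ p) := hp.continuous_fderiv one_ne_zero
  have horiz : ∀ y ∈ Set.uIcc z.im w.im,
      ∫ x in z.re..w.re, H (x + y * Complex.I) =
        p (w.re + y * Complex.I) - p (z.re + y * Complex.I) +
          ∫ x in z.re..w.re, G (x + y * Complex.I) := by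
    intro y hy
    have hline : ∀ x : ℝ, HasDerivAt (fun x : ℝ => (x : ℂ) + y * Complex.I) 1 x := fun x => by
      simpa using (Complex.ofRealCLM.hasDerivAt (x := x)).add_const ((y : ℂ) * Complex.I)
    have := intervalIntegral.integral_eq_sub_of_hasDerivAt (a := z.re) (b := w.re)
      (f := fun x : ℝ => p (x + y * Complex.I))
      (f' := fun x : ℝ => fderiv ℝ p (x + y * Complex.I) 1)
      (fun x _ => (hpd _).hasFDerivAt.comp_hasDerivAt x (hline x))
      (Continuous.intervalIntegrable (by fun_prop) _ _)
    rw [← this, ← intervalIntegral.integral_add]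
    · exact intervalIntegral.integral_congr fun x hx => h1 _ (hmem x hx y hy)
    · exact Continuous.intervalIntegrable (by fun_prop) _ _
    · exact Continuous.intervalIntegrable (by have := hG.continuous; fun_prop) _ _
  have vert : ∀ x ∈ Set.uIcc z.re w.re,
      Complex.I • ∫ y in z.im..w.im, H (x + y * Complex.I) =
        p (x + w.im * Complex.I) - p (x + z.im * Complex.I) +
          ∫ y in z.im..w.im, F (x + y * Complex.I) := by
    intro x hx
    have hline : ∀ y : ℝ, HasDerivAt (fun y : ℝ => (x : ℂ) + y * Complex.I) Complex.I y :=
      fun y => by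
        simpa using ((Complex.ofRealCLM.hasDerivAt (x := y)).mul_const Complex.I).const_add (x : ℂ)
    have := intervalIntegral.integral_eq_sub_of_hasDerivAt (a := z.im) (b := w.im)
      (f := fun y : ℝ => p (x + y * Complex.I))
      (f' := fun y : ℝ => fderiv ℝ p (x + y * Complex.I) Complex.I)
      (fun y _ => (hpd _).hasFDerivAt.comp_hasDerivAt y (hline y))
      (Continuous.intervalIntegrable (by fun_prop) _ _)
    rw [← this, ← intervalIntegral.integral_add, ← intervalIntegral.integral_smul]
    · exact intervalIntegral.integral_congr fun y hy => hI _ (hmem x hx y hy)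
    · exact Continuous.intervalIntegrable (by fun_prop) _ _
    · exact Continuous.intervalIntegrable (by have := hF.continuous; fun_prop) _ _
  let e : ℝ × ℝ →L[ℝ] ℂ := Complex.equivRealProdCLM.symm
  have he : ∀ x y : ℝ, e (x, y) = x + y * Complex.I := fun x y => Complex.mk_eq_add_mul_I x y
  have he1 : e (1, 0) = 1 := rfl
  have heI : e (0, 1) = Complex.I := rfl
  have hzero : ∀ q ∈ Set.uIcc z.re w.re ×ˢ Set.uIcc z.im w.im,
      ((fderiv ℝ F (e q)).comp e) (1, 0) + (-(fderiv ℝ G (e q)).comp e) (0, 1) = 0 := by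
    rintro ⟨x, y⟩ ⟨hx, hy⟩
    have := hFG _ (hmem x hx y hy)
    simp only [ContinuousLinearMap.comp_apply, neg_apply, he1, heI, he, this]
    simp
  have green := MeasureTheory.integral2_divergence_prod_of_hasFDerivAt
    (fun q => F (e q)) (fun q => -G (e q))
    (fun q => (fderiv ℝ F (e q)).comp e) (fun q => -(fderiv ℝ G (e q)).comp e)
    z.re z.im w.re w.im
    (by have := hF.continuous; fun_prop) (by have := hG.continuous; fun_prop)
    (fun q _ => (hFd _).hasFDerivAt.comp q e.hasFDerivAt)
    (fun q _ => ((hGd _).hasFDerivAt.comp q e.hasFDerivAt).neg)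
    ((MeasureTheory.integrableOn_congr_fun hzero
      (measurableSet_uIcc.prod measurableSet_uIcc)).2 integrableOn_zero)
  rw [intervalIntegral.integral_congr (g := fun _ => 0) (fun x hx =>
    (intervalIntegral.integral_congr (g := fun _ => 0)
      (fun y hy => hzero (x, y) ⟨hx, hy⟩)).trans (by simp))] at green
  simp only [he, intervalIntegral.integral_neg, intervalIntegral.integral_zero] at green
  rw [horiz _ Set.left_mem_uIcc, horiz _ Set.right_mem_uIcc, vert _ Set.left_mem_uIcc,
    vert _ Set.right_mem_uIcc]
  linear_combination -green

lemma eqOn_zero_of_im_eq_zero_on_sphere {f : ℂ → ℂ} (hf : DiffContOnCl ℂ f (Metric.ball 0 1))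
    (hS : ∀ z ∈ Metric.sphere (0 : ℂ) 1, (f z).im = 0) (h0 : f 0 = 0) :
    ∀ z ∈ Metric.ball (0 : ℂ) 1, f z = 0 := by
  have key : ∀ t : ℝ, ∀ z ∈ Metric.ball (0 : ℂ) 1, Complex.exp (-Complex.I * (t * f z)) = 1 := by
    intro t z hz
    have hg : DiffContOnCl ℂ (fun z => Complex.exp (-Complex.I * (t * f z))) (Metric.ball 0 1) := by
      refine ⟨?_, ?_⟩
      · have := hf.differentiableOn
        fun_prop
      · have := hf.continuousOn
        fun_prop
    have hmax : IsMaxOn (norm ∘ fun z => Complex.exp (-Complex.I * (t * f z)))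
        (Metric.ball (0 : ℂ) 1) 0 := by
      intro y hy
      have := Complex.norm_le_of_forall_mem_frontier_norm_le (C := 1) Metric.isBounded_ball hg
        (fun x hx => by
          rw [frontier_ball (0 : ℂ) one_ne_zero] at hx
          simp [Complex.norm_exp, hS x hx]) (subset_closure hy)
      simpa [h0] using this
    have := Complex.eqOn_of_isPreconnected_of_isMaxOn_norm
      (convex_ball (0 : ℂ) 1).isPreconnected Metric.isOpen_ball hg.differentiableOn
      (Metric.mem_ball_self one_pos) hmax hz
    simpa [h0] using this
  intro z hz
  have hd : HasDerivAt (fun t : ℝ => Complex.exp (-Complex.I * (t * f z)))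
      (Complex.exp (-Complex.I * ((0 : ℝ) * f z)) * (-Complex.I * (1 * f z))) 0 :=
    (((Complex.ofRealCLM.hasDerivAt (x := (0 : ℝ))).mul_const (f z)).const_mul
      (-Complex.I)).cexp
  have hc : (fun t : ℝ => Complex.exp (-Complex.I * (t * f z))) = fun _ => 1 :=
    funext fun t => key t z hz
  rw [hc] at hd
  simpa using (hd.unique (hasDerivAt_const (0 : ℝ) (1 : ℂ)))

lemma fderiv_tangent_eq_zero {g : ℂ → ℝ} {z : ℂ} (hg : DifferentiableAt ℝ g z)
    (hS : ∀ x ∈ Metric.sphere (0 : ℂ) 1, g x = 0) (hz : z ∈ Metric.sphere (0 : ℂ) 1) :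
    fderiv ℝ g z (Complex.I * z) = 0 := by
  have hc : HasDerivAt (fun t : ℝ => z * Complex.exp (t * Complex.I)) (Complex.I * z) 0 := by
    have := (((Complex.ofRealCLM.hasDerivAt (x := (0 : ℝ))).mul_const Complex.I).cexp).const_mul z
    simpa [mul_comm] using this
  have h2 : HasDerivAt (fun t : ℝ => g (z * Complex.exp (t * Complex.I)))
      (fderiv ℝ g z (Complex.I * z)) 0 := by
    have hg' : HasFDerivAt g (fderiv ℝ g z) (z * Complex.exp ((0 : ℝ) * Complex.I)) := by
      simpa using hg.hasFDerivAt
    exact hg'.comp_hasDerivAt (0 : ℝ) hc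
  have h3 : (fun t : ℝ => g (z * Complex.exp (t * Complex.I))) = fun _ => 0 :=
    funext fun t => hS _ (by
      simp only [mem_sphere_iff_norm, sub_zero] at hz ⊢
      rw [norm_mul, hz, Complex.norm_exp_ofReal_mul_I, one_mul])
  rw [h3] at h2
  exact h2.unique (hasDerivAt_const _ _)

lemma contDiff_dirDeriv {u : ℂ → ℝ} (hu : ContDiff ℝ 2 u) (e : ℂ) :
    ContDiff ℝ 1 (dirDeriv e u) :=
  (hu.fderiv_right (m := 1) (by norm_num)).clm_apply contDiff_const

lemma dirDeriv_comm {u : ℂ → ℝ} (hu : ContDiff ℝ 2 u) (d e z : ℂ) :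
    dirDeriv d (dirDeriv e u) z = dirDeriv e (dirDeriv d u) z := by
  have hd : DifferentiableAt ℝ (fderiv ℝ u) z :=
    ((hu.fderiv_right (m := 1) (by norm_num)).differentiable one_ne_zero) z
  have h : ∀ a b : ℂ, dirDeriv a (dirDeriv b u) z = fderiv ℝ (fderiv ℝ u) z a b := by
    intro a b
    have := (hd.hasFDerivAt.clm_apply (hasFDerivAt_const b z)).fderiv
    change fderiv ℝ (fun y => fderiv ℝ u y b) z a = _
    rw [this]
    simp
  rw [h, h]
  exact (hu.contDiffAt.isSymmSndFDerivAt (by simp)) d e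

lemma fderiv_apply_eq_dirDeriv (u : ℂ → ℝ) (z ζ : ℂ) :
    fderiv ℝ u z ζ = ζ.re * dirDeriv 1 u z + ζ.im * dirDeriv Complex.I u z := by
  conv_lhs => rw [show ζ = ζ.re • (1 : ℂ) + ζ.im • Complex.I by simp]
  simp only [map_add, map_smul, smul_eq_mul, dirDeriv]

lemma exists_eq_const_of_dirDeriv_eq_zero {u : ℂ → ℝ} (hu : Differentiable ℝ u)
    (h1 : ∀ z ∈ Metric.ball (0 : ℂ) 1, dirDeriv 1 u z = 0)
    (hI : ∀ z ∈ Metric.ball (0 : ℂ) 1, dirDeriv Complex.I u z = 0) :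
    ∃ c, ∀ z ∈ Metric.closedBall (0 : ℂ) 1, u z = c := by
  obtain ⟨c, hc⟩ := Metric.isOpen_ball.exists_is_const_of_fderiv_eq_zero
    (convex_ball (0 : ℂ) 1).isPreconnected hu.differentiableOn (fun z hz => by
      ext ζ
      rw [fderiv_apply_eq_dirDeriv, h1 z hz, hI z hz]
      simp)
  refine ⟨c, fun z hz => ?_⟩
  rw [← closure_ball (0 : ℂ) one_ne_zero] at hz
  exact (isClosed_eq hu.continuous continuous_const).closure_subset_iff.2 hc hz

/-- The Hopf differential `∂²v - (∂v)² / 2` multiplied by `-2`. -/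
def hopf (v : ℂ → ℝ) (z : ℂ) : ℂ :=
  ⟨(dirDeriv Complex.I (dirDeriv Complex.I v) z - dirDeriv 1 (dirDeriv 1 v) z) / 2 +
      (dirDeriv 1 v z ^ 2 - dirDeriv Complex.I v z ^ 2) / 4,
    dirDeriv 1 (dirDeriv Complex.I v) z - dirDeriv 1 v z * dirDeriv Complex.I v z / 2⟩

lemma continuous_hopf {v : ℂ → ℝ} (hv : ContDiff ℝ 2 v) : Continuous (hopf v) := by
  have c1 := (contDiff_dirDeriv hv 1).continuous
  have cI := (contDiff_dirDeriv hv Complex.I).continuous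
  have c2 : ∀ d e, Continuous (dirDeriv d (dirDeriv e v)) := fun d e =>
    ((contDiff_dirDeriv hv e).continuous_fderiv one_ne_zero).clm_apply continuous_const
  have := c2 1 1
  have := c2 1 Complex.I
  have := c2 Complex.I Complex.I
  have h : hopf v = fun z => Complex.equivRealProdCLM.symm (_, _) := rfl
  rw [h]
  refine Complex.equivRealProdCLM.symm.continuous.comp (Continuous.prodMk ?_ ?_) <;> fun_prop

lemma differentiableOn_hopf {K : ℝ} {v : ℂ → ℝ} (hv : ContDiff ℝ 2 v)
    (hK : ∀ z ∈ Metric.ball (0 : ℂ) 1, -lap v z = 2 * K * Real.exp (v z)) :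
    DifferentiableOn ℂ (hopf v) (Metric.ball 0 1) := by
  refine (Complex.isConservativeOn_and_continuousOn_iff_isDifferentiableOn Metric.isOpen_ball).1
    ⟨?_, (continuous_hopf hv).continuousOn⟩
  have d1 := contDiff_dirDeriv hv 1
  have dI := contDiff_dirDeriv hv Complex.I
  have ofReal : ∀ {u : ℂ → ℝ}, ContDiff ℝ 1 u → ContDiff ℝ 1 fun z => (u z : ℂ) := fun hu =>
    Complex.ofRealCLM.contDiff.comp hu
  set π : ℂ → ℂ := fun z => dirDeriv 1 v z - Complex.I * dirDeriv Complex.I v z with hπ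
  set q : ℂ → ℂ := fun z => (Real.exp (v z) : ℝ) with hq
  have cπ : ContDiff ℝ 1 π := (ofReal d1).sub (contDiff_const.mul (ofReal dI))
  have cq : ContDiff ℝ 1 q := ofReal (hv.of_le (by norm_num)).exp
  have fπ : ∀ z e, fderiv ℝ π z e = dirDeriv e (dirDeriv 1 v) z
      - Complex.I * dirDeriv e (dirDeriv Complex.I v) z := by
    intro z e
    have h1 := Complex.ofRealCLM.hasFDerivAt.comp z
      (d1.differentiable one_ne_zero z).hasFDerivAt
    have h2 := Complex.ofRealCLM.hasFDerivAt.comp z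
      (dI.differentiable one_ne_zero z).hasFDerivAt
    have h := (h1.sub (h2.const_mul Complex.I)).fderiv
    change fderiv ℝ π z = _ at h
    rw [h]
    simp [dirDeriv]
  have fq : ∀ z e, fderiv ℝ q z e = Real.exp (v z) * dirDeriv e v z := by
    intro z e
    have h := (Complex.ofRealCLM.hasFDerivAt.comp z
      (hv.differentiable two_ne_zero z).hasFDerivAt.exp).fderiv
    change fderiv ℝ q z = _ at h
    rw [h]
    simp [dirDeriv]
  have dπ := cπ.differentiable one_ne_zero
  have dq := cq.differentiable one_ne_zero
  have fc : ∀ (c : ℂ) z e, fderiv ℝ (fun z => π z ^ 2 / 4 + c * q z) z e =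
      π z * fderiv ℝ π z e / 2 + c * fderiv ℝ q z e := by
    intro c z e
    have h := (((dπ z).hasFDerivAt.mul (dπ z).hasFDerivAt).const_mul (1 / 4 : ℂ)).add
      ((dq z).hasFDerivAt.const_mul c)
    have h' : HasFDerivAt (fun z => π z ^ 2 / 4 + c * q z) _ z :=
      h.congr_of_eventuallyEq (Eventually.of_forall fun x => by simp; ring)
    rw [h'.fderiv]
    simp
    ring
  have cc : ∀ c : ℂ, ContDiff ℝ 1 (fun z => π z ^ 2 / 4 + c * q z) := fun c =>
    ((cπ.pow 2).div_const 4).add (contDiff_const.mul cq)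
  refine isConservativeOn_of_potential (p := fun z => -π z)
    (F := fun z => Complex.I * (π z ^ 2 / 4 + (K : ℂ) * q z))
    (G := fun z => π z ^ 2 / 4 + (-K : ℂ) * q z) cπ.neg (contDiff_const.mul (cc _)) (cc _)
    ?_ ?_ ?_
  · intro z hz
    have := hK z hz
    have hs := dirDeriv_comm hv 1 Complex.I z
    simp only [lap] at this
    rw [fderiv_fun_neg, neg_apply, fπ]
    apply Complex.ext <;> simp [hopf, hπ, hq, pow_two, -Complex.ofReal_exp] <;> linarith
  · intro z hz
    have := hK z hz
    have hs := dirDeriv_comm hv 1 Complex.I z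
    simp only [lap] at this
    rw [fderiv_fun_neg, neg_apply, fπ]
    apply Complex.ext <;> simp [hopf, hπ, hq, pow_two, -Complex.ofReal_exp] <;> linarith
  · intro z hz
    have := hK z hz
    have hs := dirDeriv_comm hv 1 Complex.I z
    have hL : (dirDeriv 1 (dirDeriv 1 v) z : ℂ) + dirDeriv Complex.I (dirDeriv Complex.I v) z
        = - 2 * K * Real.exp (v z) := by
      have h : dirDeriv 1 (dirDeriv 1 v) z + dirDeriv Complex.I (dirDeriv Complex.I v) z
          = -2 * K * Real.exp (v z) := by
        simp only [lap] at this
        linarith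
      exact_mod_cast congrArg (fun x : ℝ => (x : ℂ)) h
    rw [fderiv_const_mul ((cc _).differentiable one_ne_zero z)]
    rw [smul_apply, fc, fc, fπ, fπ, fq, fq, hs]
    simp only [hπ, smul_eq_mul]
    linear_combination (Complex.I / 2 * (dirDeriv 1 v z - Complex.I * dirDeriv Complex.I v z)) * hL +
      (-(dirDeriv 1 v z * dirDeriv Complex.I (dirDeriv 1 v) z) / 2
        + dirDeriv Complex.I v z * K * Real.exp (v z)
        + Complex.I * dirDeriv Complex.I v z * dirDeriv Complex.I (dirDeriv 1 v) z / 2)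
        * Complex.I_sq

lemma hopf_eq_zero {K h : ℝ} {v : ℂ → ℝ} (hv : ContDiff ℝ 2 v)
    (hs : SolvesLiouvilleConst K h v) : ∀ z ∈ Metric.ball (0 : ℂ) 1, hopf v z = 0 := by
  have d1 := contDiff_dirDeriv hv 1
  have dI := contDiff_dirDeriv hv Complex.I
  have hd : DiffContOnCl ℂ (fun z => z ^ 2 * hopf v z) (Metric.ball 0 1) :=
    ⟨(differentiableOn_pow 2).mul (differentiableOn_hopf hv hs.1),
      ((continuous_pow 2).mul (continuous_hopf hv)).continuousOn⟩
  have him : ∀ z ∈ Metric.sphere (0 : ℂ) 1, (z ^ 2 * hopf v z).im = 0 := by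
    intro z hz
    have hx := (d1.differentiable one_ne_zero z).hasFDerivAt
    have hy := (dI.differentiable one_ne_zero z).hasFDerivAt
    have hg := (((Complex.reCLM.hasFDerivAt (x := z)).mul hx).add
      ((Complex.imCLM.hasFDerivAt (x := z)).mul hy)).sub
      (((hv.differentiable two_ne_zero z).hasFDerivAt.const_mul (1 / 2)).exp.const_mul (2 * h))
    have h0 := fderiv_tangent_eq_zero (hg.add_const 2).differentiableAt (fun x hx => by
      have := hs.2 x hx
      rw [normalDeriv, fderiv_apply_eq_dirDeriv, div_eq_inv_mul] at this
      simp
      linarith) hz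
    rw [(hg.add_const 2).fderiv] at h0
    have hb := hs.2 z hz
    rw [normalDeriv, fderiv_apply_eq_dirDeriv, div_eq_inv_mul] at hb
    have hsym := dirDeriv_comm hv 1 Complex.I z
    simp [fderiv_apply_eq_dirDeriv] at h0
    simp [hopf, pow_two]
    rw [hsym] at h0 ⊢
    linear_combination h0
      - (z.re * dirDeriv Complex.I v z - z.im * dirDeriv 1 v z) / 2 * hb
  intro z hz
  have hz2 := eqOn_zero_of_im_eq_zero_on_sphere hd him (by simp)
  have hne : ∀ z ∈ Metric.ball (0 : ℂ) 1, z ≠ 0 → hopf v z = 0 := fun z hz h0 => by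
    simpa [h0] using hz2 z hz
  by_cases h0 : z = 0
  · subst h0
    have hm : (0 : ℂ) ∈ closure (Metric.ball (0 : ℂ) 1 ∩ {0}ᶜ) :=
      (dense_compl_singleton (0 : ℂ)).open_subset_closure_inter Metric.isOpen_ball hz
    exact (isClosed_eq (continuous_hopf hv) continuous_const).closure_subset_iff.2
      (fun z hz => hne z hz.1 hz.2) hm
  · exact hne z hz h0

lemma hasFDerivAt_exp_neg_half {v : ℂ → ℝ} {z : ℂ} (hv : DifferentiableAt ℝ v z) :
    HasFDerivAt (fun z => Real.exp (-v z / 2))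
      ((-Real.exp (-v z / 2) / 2) • fderiv ℝ v z) z := by
  have h := (hv.hasFDerivAt.const_mul (-1 / 2)).exp
  have e : (fun z => Real.exp (-1 / 2 * v z)) = fun z => Real.exp (-v z / 2) := by
    funext z
    ring_nf
  rw [e] at h
  refine h.congr_fderiv ?_
  rw [smul_smul]
  ring_nf

/-- A positive `C²` function with vanishing `∂²w` in the disk and `w Δw - |∇w|² = K` is there a
quadratic polynomial with radial leading part. -/
lemma exists_quadratic {K : ℝ} {w : ℂ → ℝ} (hw : ContDiff ℝ 2 w) (hpos : ∀ z, 0 < w z)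
    (h12 : ∀ z ∈ Metric.ball (0 : ℂ) 1, dirDeriv 1 (dirDeriv Complex.I w) z = 0)
    (h11 : ∀ z ∈ Metric.ball (0 : ℂ) 1,
      dirDeriv 1 (dirDeriv 1 w) z = dirDeriv Complex.I (dirDeriv Complex.I w) z)
    (hK : ∀ z ∈ Metric.ball (0 : ℂ) 1, 2 * w z * dirDeriv 1 (dirDeriv 1 w) z
      = K + dirDeriv 1 w z ^ 2 + dirDeriv Complex.I w z ^ 2) :
    ∃ A B C D : ℝ, 4 * A * D - B ^ 2 - C ^ 2 = K ∧ ∀ z ∈ Metric.closedBall (0 : ℂ) 1,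
      w z = A * ‖z‖ ^ 2 + B * z.re + C * z.im + D ∧
      dirDeriv 1 w z = 2 * A * z.re + B ∧ dirDeriv Complex.I w z = 2 * A * z.im + C := by
  have d1 := contDiff_dirDeriv hw 1
  have dI := contDiff_dirDeriv hw Complex.I
  have e1 : Differentiable ℝ (dirDeriv 1 w) := d1.differentiable one_ne_zero
  have eI : Differentiable ℝ (dirDeriv Complex.I w) := dI.differentiable one_ne_zero
  have e0 : Differentiable ℝ w := hw.differentiable two_ne_zero
  have h21 : ∀ z ∈ Metric.ball (0 : ℂ) 1, dirDeriv Complex.I (dirDeriv 1 w) z = 0 := fun z hz => by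
    rw [dirDeriv_comm hw, h12 z hz]
  let m : ℂ → ℝ := fun z => (K + dirDeriv 1 w z ^ 2 + dirDeriv Complex.I w z ^ 2) / (2 * w z)
  have hm : Differentiable ℝ m := by
    have hn : Differentiable ℝ fun z => K + dirDeriv 1 w z ^ 2 + dirDeriv Complex.I w z ^ 2 := by
      fun_prop
    exact hn.mul ((e0.const_mul 2).inv fun z => (mul_pos two_pos (hpos z)).ne')
  have hmw : ∀ z, 2 * w z * m z = K + dirDeriv 1 w z ^ 2 + dirDeriv Complex.I w z ^ 2 := fun z =>
    mul_div_cancel₀ _ (mul_pos two_pos (hpos z)).ne'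
  have hm11 : ∀ z ∈ Metric.ball (0 : ℂ) 1, dirDeriv 1 (dirDeriv 1 w) z = m z := fun z hz =>
    mul_left_cancel₀ (mul_pos two_pos (hpos z)).ne' ((hK z hz).trans (hmw z).symm)
  have hfm : ∀ z e, 2 * (w z * dirDeriv e m z + m z * dirDeriv e w z) =
      2 * dirDeriv 1 w z * dirDeriv e (dirDeriv 1 w) z +
        2 * dirDeriv Complex.I w z * dirDeriv e (dirDeriv Complex.I w) z := by
    intro z e
    have hl := ((e0 z).hasFDerivAt.const_mul 2).mul (hm z).hasFDerivAt
    have hr := (((e1 z).hasFDerivAt.pow 2).const_add K).add ((eI z).hasFDerivAt.pow 2)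
    have := congrArg (fun L : ℂ →L[ℝ] ℝ => L e)
      (hl.unique (hr.congr_of_eventuallyEq (Eventually.of_forall fun x => by
        simpa using hmw x)))
    simp at this
    simp only [dirDeriv] at this ⊢
    linarith
  obtain ⟨a, ha⟩ := exists_eq_const_of_dirDeriv_eq_zero hm
    (fun z hz => by
      have := hfm z 1
      rw [h12 z hz, hm11 z hz] at this
      have h0 : w z * dirDeriv 1 m z = 0 := by linarith
      exact (mul_eq_zero.1 h0).resolve_left (hpos z).ne')
    (fun z hz => by
      have := hfm z Complex.I
      rw [h21 z hz, ← h11 z hz, hm11 z hz] at this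
      have h0 : w z * dirDeriv Complex.I m z = 0 := by linarith
      exact (mul_eq_zero.1 h0).resolve_left (hpos z).ne')
  have hb : ∀ z ∈ Metric.ball (0 : ℂ) 1, m z = a := fun z hz => ha z (Metric.ball_subset_closedBall hz)
  have dre : ∀ (z : ℂ) (u : ℂ → ℝ) (hu : Differentiable ℝ u) (e : ℂ),
      dirDeriv e (fun z => u z - a * z.re) z = dirDeriv e u z - a * e.re := by
    intro z u hu e
    have h := (hu z).hasFDerivAt.sub ((Complex.reCLM.hasFDerivAt (x := z)).const_mul a)
    change fderiv ℝ (fun z => u z - a * z.re) z e = _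
    rw [show fderiv ℝ (fun z => u z - a * z.re) z = _ from h.fderiv]
    simp [dirDeriv]
  have dim : ∀ (z : ℂ) (u : ℂ → ℝ) (hu : Differentiable ℝ u) (e : ℂ),
      dirDeriv e (fun z => u z - a * z.im) z = dirDeriv e u z - a * e.im := by
    intro z u hu e
    have h := (hu z).hasFDerivAt.sub ((Complex.imCLM.hasFDerivAt (x := z)).const_mul a)
    change fderiv ℝ (fun z => u z - a * z.im) z e = _
    rw [show fderiv ℝ (fun z => u z - a * z.im) z = _ from h.fderiv]
    simp [dirDeriv]
  have reD : Differentiable ℝ Complex.re := Complex.reCLM.differentiable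
  have imD : Differentiable ℝ Complex.im := Complex.imCLM.differentiable
  obtain ⟨B, hB⟩ := exists_eq_const_of_dirDeriv_eq_zero
    (u := fun z => dirDeriv 1 w z - a * z.re) (by fun_prop)
    (fun z hz => by rw [dre z _ e1, hm11 z hz, hb z hz]; simp)
    (fun z hz => by rw [dre z _ e1, h21 z hz]; simp)
  obtain ⟨C, hC⟩ := exists_eq_const_of_dirDeriv_eq_zero
    (u := fun z => dirDeriv Complex.I w z - a * z.im) (by fun_prop)
    (fun z hz => by rw [dim z _ eI, h12 z hz]; simp)
    (fun z hz => by rw [dim z _ eI, ← h11 z hz, hm11 z hz, hb z hz]; simp)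
  have dq : ∀ z e : ℂ, dirDeriv e (fun z => w z - (a / 2 * (z.re * z.re + z.im * z.im)
      + B * z.re + C * z.im)) z = dirDeriv e w z - (a * (z.re * e.re + z.im * e.im)
      + B * e.re + C * e.im) := by
    intro z e
    have hr := Complex.reCLM.hasFDerivAt (x := z)
    have hi := Complex.imCLM.hasFDerivAt (x := z)
    have h := (e0 z).hasFDerivAt.sub
      (((((hr.mul hr).add (hi.mul hi)).const_mul (a / 2)).add (hr.const_mul B)).add
        (hi.const_mul C))
    change fderiv ℝ (fun z : ℂ => w z - (a / 2 * (z.re * z.re + z.im * z.im)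
      + B * z.re + C * z.im)) z e = _
    rw [show fderiv ℝ (fun z : ℂ => w z - (a / 2 * (z.re * z.re + z.im * z.im)
      + B * z.re + C * z.im)) z = _ from h.fderiv]
    simp [dirDeriv]
    ring
  obtain ⟨D, hD⟩ := exists_eq_const_of_dirDeriv_eq_zero
    (u := fun z => w z - (a / 2 * (z.re * z.re + z.im * z.im) + B * z.re + C * z.im))
    (by fun_prop)
    (fun z hz => by
      have := hB z (Metric.ball_subset_closedBall hz)
      rw [dq]
      simp at this ⊢
      linarith)
    (fun z hz => by
      have := hC z (Metric.ball_subset_closedBall hz)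
      rw [dq]
      simp at this ⊢
      linarith)
  have h0 : (0 : ℂ) ∈ Metric.closedBall (0 : ℂ) 1 := by simp
  refine ⟨a / 2, B, C, D, ?_, fun z hz => ⟨?_, ?_, ?_⟩⟩
  · have hB0 := hB 0 h0
    have hC0 := hC 0 h0
    have hD0 := hD 0 h0
    have := hmw 0
    rw [ha 0 h0] at this
    simp at hB0 hC0 hD0
    rw [hB0, hC0, hD0] at this
    linarith
  · have := hD z hz
    rw [← Complex.normSq_eq_norm_sq, Complex.normSq_apply]
    linarith
  · have := hB z hz
    linarith
  · have := hC z hz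
    linarith

lemma exists_quadratic_of_solves {K h : ℝ} {v : ℂ → ℝ} (hv : ContDiff ℝ 2 v)
    (hs : SolvesLiouvilleConst K h v) :
    ∃ A B C D : ℝ, 4 * A * D - B ^ 2 - C ^ 2 = K ∧ D - A = h ∧
      ∀ z ∈ Metric.closedBall (0 : ℂ) 1,
        Real.exp (-v z / 2) = A * ‖z‖ ^ 2 + B * z.re + C * z.im + D := by
  set w : ℂ → ℝ := fun z => Real.exp (-v z / 2) with hwdef
  have e0 : Differentiable ℝ v := hv.differentiable two_ne_zero
  have hw : ContDiff ℝ 2 w := (hv.neg.div_const 2).exp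
  have hpos : ∀ z, 0 < w z := fun z => Real.exp_pos _
  have hw2 : ∀ z, w z * w z * Real.exp (v z) = 1 := fun z => by
    simp only [hwdef, ← Real.exp_add]
    rw [← Real.exp_zero]
    ring_nf
  have hw1 : ∀ z, w z * Real.exp (v z / 2) = 1 := fun z => by
    simp only [hwdef, ← Real.exp_add]
    rw [← Real.exp_zero]
    ring_nf
  have f1 : ∀ e z, dirDeriv e w z = -w z / 2 * dirDeriv e v z := fun e z => by
    change fderiv ℝ w z e = _
    rw [show fderiv ℝ w z = _ from (hasFDerivAt_exp_neg_half (e0 z)).fderiv]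
    simp [dirDeriv, hwdef]
  have f2 : ∀ d e z, dirDeriv d (dirDeriv e w) z =
      w z / 4 * dirDeriv d v z * dirDeriv e v z - w z / 2 * dirDeriv d (dirDeriv e v) z := by
    intro d e z
    have h := ((hw.differentiable two_ne_zero z).hasFDerivAt.const_mul (-1 / 2)).mul
      (((contDiff_dirDeriv hv e).differentiable one_ne_zero) z).hasFDerivAt
    have h' : HasFDerivAt (dirDeriv e w) _ z :=
      h.congr_of_eventuallyEq (Eventually.of_forall fun x => by
        rw [f1, Pi.mul_apply]
        ring)
    have := f1 d z
    rw [dirDeriv, h'.fderiv]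
    simp only [dirDeriv] at this ⊢
    simp [this]
    ring
  have hz0 := hopf_eq_zero hv hs
  obtain ⟨A, B, C, D, hK, hq⟩ := exists_quadratic (K := K) hw hpos
    (fun z hz => by
      have := congrArg Complex.im (hz0 z hz)
      simp only [hopf, Complex.zero_im] at this
      rw [f2]
      linear_combination (-w z / 2) * this)
    (fun z hz => by
      have := congrArg Complex.re (hz0 z hz)
      simp only [hopf, Complex.zero_re] at this
      rw [f2, f2]
      linear_combination w z * this)
    (fun z hz => by
      have h1 := congrArg Complex.re (hz0 z hz)
      simp only [hopf, Complex.zero_re] at h1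
      have h2 := hs.1 z hz
      have h3 := hw2 z
      simp only [lap] at h2
      rw [f2, f1, f1]
      linear_combination (w z) ^ 2 * h1 + (w z) ^ 2 / 2 * h2 + K * h3)
  refine ⟨A, B, C, D, hK, ?_, fun z hz => (hq z hz).1⟩
  have h1 : (1 : ℂ) ∈ Metric.closedBall (0 : ℂ) 1 := by simp
  obtain ⟨q0, q1, -⟩ := hq 1 h1
  have hb := hs.2 1 (by simp [unitCircle])
  rw [normalDeriv, fderiv_apply_eq_dirDeriv] at hb
  have := hw1 1
  rw [f1] at q1
  simp at q0 q1 hb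
  linear_combination (-1) * q0 + (1 : ℝ) * q1 + w 1 / 2 * hb + h * this

/-- The quadratic polynomial `A|z|² + Bx + Cy + D`. -/
def radialQuadratic (A B C D : ℝ) (z : ℂ) : ℝ := A * ‖z‖ ^ 2 + B * z.re + C * z.im + D

lemma radialQuadratic_eq (A B C D : ℝ) :
    radialQuadratic A B C D =
      fun z => A * (z.re * z.re + z.im * z.im) + B * z.re + C * z.im + D := by
  funext z
  rw [radialQuadratic, ← Complex.normSq_eq_norm_sq, Complex.normSq_apply]

lemma contDiff_radialQuadratic (A B C D : ℝ) : ContDiff ℝ 2 (radialQuadratic A B C D) := by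
  have hr : ContDiff ℝ 2 Complex.re := Complex.reCLM.contDiff
  have hi : ContDiff ℝ 2 Complex.im := Complex.imCLM.contDiff
  rw [radialQuadratic_eq]
  fun_prop

lemma dirDeriv_radialQuadratic (A B C D : ℝ) (e z : ℂ) :
    dirDeriv e (radialQuadratic A B C D) z =
      2 * A * (z.re * e.re + z.im * e.im) + B * e.re + C * e.im := by
  have hr := Complex.reCLM.hasFDerivAt (x := z)
  have hi := Complex.imCLM.hasFDerivAt (x := z)
  have h := (((((hr.mul hr).add (hi.mul hi)).const_mul A).add (hr.const_mul B)).add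
    (hi.const_mul C)).add_const D
  rw [dirDeriv, radialQuadratic_eq]
  rw [show fderiv ℝ (fun z : ℂ => A * (z.re * z.re + z.im * z.im) + B * z.re + C * z.im + D) z = _
    from h.fderiv]
  simp
  ring

lemma dirDeriv_dirDeriv_radialQuadratic (A B C D : ℝ) (e z : ℂ) :
    dirDeriv e (dirDeriv e (radialQuadratic A B C D)) z = 2 * A * (e.re * e.re + e.im * e.im) := by
  have hr := Complex.reCLM.hasFDerivAt (x := z)
  have hi := Complex.imCLM.hasFDerivAt (x := z)
  have h := ((((hr.mul_const e.re).add (hi.mul_const e.im)).const_mul (2 * A)).add_const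
    (B * e.re)).add_const (C * e.im)
  rw [funext (dirDeriv_radialQuadratic A B C D e), dirDeriv]
  rw [show fderiv ℝ (fun z : ℂ => 2 * A * (z.re * e.re + z.im * e.im) + B * e.re + C * e.im) z = _
    from h.fderiv]
  simp
  ring

lemma dirDeriv_neg_two_log {u P : ℂ → ℝ} {z : ℂ} (hP : DifferentiableAt ℝ P z) (h0 : 0 < P z)
    (hu : u =ᶠ[nhds z] fun z => -2 * Real.log (P z)) (e : ℂ) :
    dirDeriv e u z = -2 * (dirDeriv e P z * (P z)⁻¹) := by
  have h := (hP.hasFDerivAt.log h0.ne').const_mul (-2)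
  rw [dirDeriv, (h.congr_of_eventuallyEq hu).fderiv]
  simp [dirDeriv]
  ring

lemma dirDeriv_dirDeriv_neg_two_log {u P : ℂ → ℝ} {z : ℂ} (hP : ContDiff ℝ 2 P) (h0 : 0 < P z)
    (hu : u =ᶠ[nhds z] fun z => -2 * Real.log (P z)) (e : ℂ) :
    dirDeriv e (dirDeriv e u) z =
      -2 * (dirDeriv e (dirDeriv e P) z * (P z)⁻¹ - (dirDeriv e P z * (P z)⁻¹) ^ 2) := by
  have dP : Differentiable ℝ P := hP.differentiable two_ne_zero
  have hev : dirDeriv e u =ᶠ[nhds z] fun z => -2 * (dirDeriv e P z * (P z)⁻¹) := by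
    filter_upwards [hu.eventuallyEq_nhds, hP.continuous.continuousAt.eventually (lt_mem_nhds h0)]
      with x hx hx0
    exact dirDeriv_neg_two_log (dP x) hx0 hx e
  have h := ((((contDiff_dirDeriv hP e).differentiable one_ne_zero) z).hasFDerivAt.mul
    ((hasDerivAt_inv h0.ne').comp_hasFDerivAt z (dP z).hasFDerivAt)).const_mul (-2)
  rw [dirDeriv, (h.congr_of_eventuallyEq hev).fderiv]
  simp [dirDeriv]
  ring

lemma solves_of_eventuallyEq_log {A B C D : ℝ} {u : ℂ → ℝ}
    (hpos : ∀ z ∈ Metric.closedBall (0 : ℂ) 1, 0 < radialQuadratic A B C D z)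
    (hu : ∀ z ∈ Metric.closedBall (0 : ℂ) 1,
      u =ᶠ[nhds z] fun z => -2 * Real.log (radialQuadratic A B C D z)) :
    SolvesLiouvilleConst (4 * A * D - B ^ 2 - C ^ 2) (D - A) u := by
  have hexp : ∀ z ∈ Metric.closedBall (0 : ℂ) 1,
      Real.exp (u z / 2) = (radialQuadratic A B C D z)⁻¹ := fun z hz => by
    rw [(hu z hz).self_of_nhds, show ∀ x : ℝ, -2 * x / 2 = -x by intro x; ring, Real.exp_neg,
      Real.exp_log (hpos z hz)]
  refine ⟨fun z hz => ?_, fun z hz => ?_⟩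
  · have hz' := Metric.ball_subset_closedBall hz
    have hP := contDiff_radialQuadratic A B C D
    have he : Real.exp (u z) = (radialQuadratic A B C D z)⁻¹ ^ 2 := by
      rw [← hexp z hz', ← Real.exp_nat_mul]
      ring_nf
    rw [lap, he, dirDeriv_dirDeriv_neg_two_log hP (hpos z hz') (hu z hz'),
      dirDeriv_dirDeriv_neg_two_log hP (hpos z hz') (hu z hz'),
      dirDeriv_dirDeriv_radialQuadratic, dirDeriv_dirDeriv_radialQuadratic,
      dirDeriv_radialQuadratic, dirDeriv_radialQuadratic]
    have hp := (hpos z hz').ne'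
    have hPz := congrFun (radialQuadratic_eq A B C D) z
    generalize radialQuadratic A B C D z = p at *
    field_simp
    rw [hPz]
    simp
    ring
  · have hz' := Metric.sphere_subset_closedBall hz
    rw [hexp z hz', normalDeriv]
    change dirDeriv z u z + 2 = _
    rw [dirDeriv_neg_two_log ((contDiff_radialQuadratic A B C D).differentiable two_ne_zero z)
      (hpos z hz') (hu z hz'), dirDeriv_radialQuadratic]
    have hp := (hpos z hz').ne'
    have hn : z.re * z.re + z.im * z.im = 1 := by
      rw [← Complex.normSq_apply, Complex.normSq_eq_norm_sq, mem_sphere_zero_iff_norm.1 hz]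
      norm_num
    have hPz := congrFun (radialQuadratic_eq A B C D) z
    simp only [hn] at hPz ⊢
    generalize radialQuadratic A B C D z = p at *
    field_simp
    rw [hPz]
    ring

lemma exists_contDiff_pos_extension {P : ℂ → ℝ} (hP : ContDiff ℝ 2 P)
    (hpos : ∀ z ∈ Metric.closedBall (0 : ℂ) 1, 0 < P z) :
    ∃ Q : ℂ → ℝ, ContDiff ℝ 2 Q ∧ (∀ z, 0 < Q z) ∧
      ∀ z ∈ Metric.closedBall (0 : ℂ) 1, Q =ᶠ[nhds z] P := by
  obtain ⟨δ, hδ, hsub⟩ := (isCompact_closedBall (0 : ℂ) 1).exists_thickening_subset_open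
    (isOpen_lt continuous_const hP.continuous) hpos
  rw [thickening_closedBall hδ zero_le_one] at hsub
  let χ : ContDiffBump (0 : ℂ) := ⟨1 + δ / 2, 1 + δ, by positivity, by linarith⟩
  refine ⟨fun z => χ z * P z + (1 - χ z), ?_, fun z => ?_, fun z hz => ?_⟩
  · have : ContDiff ℝ 2 χ := χ.contDiff
    fun_prop
  · by_cases h : z ∈ Metric.ball (0 : ℂ) (1 + δ)
    · have h1 : 0 < χ z := by
        rw [← Function.mem_support.trans ⟨fun h => lt_of_le_of_ne χ.nonneg h.symm, ne_of_gt⟩]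
        rw [χ.support_eq]
        exact h
      have h2 : 0 < P z := hsub (by rwa [add_comm])
      have := χ.le_one (x := z)
      nlinarith [mul_pos h1 h2]
    · have : χ z = 0 := by
        rw [← Function.notMem_support, χ.support_eq]
        exact h
      simp [this]
  · have hb : Metric.ball (0 : ℂ) (1 + δ / 2) ∈ nhds z :=
      Metric.isOpen_ball.mem_nhds (Metric.closedBall_subset_ball (by linarith) hz)
    filter_upwards [hb] with x hx
    rw [χ.one_of_mem_closedBall (Metric.ball_subset_closedBall hx)]
    ring

section Bubble

variable {K h : ℝ}

lemma add_pos_of_solvable (hc : 0 < K ∨ (K ≤ 0 ∧ Real.sqrt (-K) < h)) : 0 < h ^ 2 + K := by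
  rcases hc with hK | ⟨hK, hh⟩
  · positivity
  · have := Real.sq_sqrt (neg_nonneg.2 hK)
    nlinarith [Real.sqrt_nonneg (-K)]

lemma phi_pos_of_solvable (hc : 0 < K ∨ (K ≤ 0 ∧ Real.sqrt (-K) < h)) :
    0 < h + Real.sqrt (h ^ 2 + K) := by
  rcases hc with hK | ⟨hK, hh⟩
  · have : |h| < Real.sqrt (h ^ 2 + K) := by
      rw [← Real.sqrt_sq_eq_abs]
      exact Real.sqrt_lt_sqrt (sq_nonneg h) (by linarith)
    linarith [neg_abs_le h]
  · have := Real.sqrt_nonneg (-K)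
    have := Real.sqrt_nonneg (h ^ 2 + K)
    linarith

lemma vBubble_eq (K φ : ℝ) (a z : ℂ) :
    vBubble K φ a z = -2 * Real.log (radialQuadratic
      ((φ ^ 2 * ‖a‖ ^ 2 + K) / (2 * φ * (1 - ‖a‖ ^ 2)))
      (-2 * (φ ^ 2 + K) * a.re / (2 * φ * (1 - ‖a‖ ^ 2)))
      (-2 * (φ ^ 2 + K) * a.im / (2 * φ * (1 - ‖a‖ ^ 2)))
      ((φ ^ 2 + K * ‖a‖ ^ 2) / (2 * φ * (1 - ‖a‖ ^ 2))) z) := by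
  rw [vBubble, ← inv_div, Real.log_inv, mul_neg, ← neg_mul]
  congr 2
  rw [radialQuadratic]
  simp only [← Complex.normSq_eq_norm_sq, Complex.normSq_apply]
  simp
  ring

lemma bubble_quadratic_pos {φ : ℝ} {a z : ℂ} (hφ : 0 < φ) (hφK : 0 < φ ^ 2 + K)
    (ha : ‖a‖ < 1) (hz : ‖z‖ ≤ 1) : 0 < radialQuadratic
      ((φ ^ 2 * ‖a‖ ^ 2 + K) / (2 * φ * (1 - ‖a‖ ^ 2)))
      (-2 * (φ ^ 2 + K) * a.re / (2 * φ * (1 - ‖a‖ ^ 2)))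
      (-2 * (φ ^ 2 + K) * a.im / (2 * φ * (1 - ‖a‖ ^ 2)))
      ((φ ^ 2 + K * ‖a‖ ^ 2) / (2 * φ * (1 - ‖a‖ ^ 2))) z := by
  have ha2 : 0 < 1 - ‖a‖ ^ 2 := by nlinarith [norm_nonneg a]
  have hz2 : 0 ≤ 1 - ‖z‖ ^ 2 := by nlinarith [norm_nonneg z]
  have hX : 0 < ‖1 - star a * z‖ ^ 2 := by
    have : ‖star a * z‖ < 1 := by
      rw [norm_mul, norm_star]
      nlinarith [norm_nonneg a, norm_nonneg z]
    have hne : 1 - star a * z ≠ 0 := fun h0 => by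
      rw [← sub_eq_zero.1 h0] at this
      simp at this
    positivity
  have hXY : ‖1 - star a * z‖ ^ 2 - ‖z - a‖ ^ 2 = (1 - ‖a‖ ^ 2) * (1 - ‖z‖ ^ 2) := by
    simp only [← Complex.normSq_eq_norm_sq, Complex.normSq_apply]
    simp
    ring
  have hden : 0 < φ ^ 2 * ‖1 - star a * z‖ ^ 2 + K * ‖z - a‖ ^ 2 := by
    rcases le_or_gt 0 K with hK | hK
    · positivity
    · nlinarith [mul_pos hφK hX, mul_nonneg ha2.le hz2]
  have : 0 < (φ ^ 2 * ‖1 - star a * z‖ ^ 2 + K * ‖z - a‖ ^ 2) / (2 * φ * (1 - ‖a‖ ^ 2)) := by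
    positivity
  convert this using 1
  rw [radialQuadratic]
  simp only [← Complex.normSq_eq_norm_sq, Complex.normSq_apply]
  simp
  ring

/-- The quadratic equation satisfied by `φ₀ = h + √(h² + K)`. -/
lemma phi_sq (hK : 0 < h ^ 2 + K) :
    (h + Real.sqrt (h ^ 2 + K)) ^ 2 = 2 * h * (h + Real.sqrt (h ^ 2 + K)) + K := by
  have := Real.sq_sqrt hK.le
  linear_combination this

lemma phi_sq_add_pos (hc : 0 < K ∨ (K ≤ 0 ∧ Real.sqrt (-K) < h)) :
    0 < (h + Real.sqrt (h ^ 2 + K)) ^ 2 + K := by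
  have hs := add_pos_of_solvable hc
  have := Real.sq_sqrt hs.le
  nlinarith [mul_pos (phi_pos_of_solvable hc) (Real.sqrt_pos.2 hs)]

/-- Every function that agrees with a bubble near the closed disk is a solution. -/
lemma solves_of_eventuallyEq_vBubble (hc : 0 < K ∨ (K ≤ 0 ∧ Real.sqrt (-K) < h)) {a : ℂ}
    (ha : ‖a‖ < 1) {u : ℂ → ℝ} (hu : ∀ z ∈ Metric.closedBall (0 : ℂ) 1,
      u =ᶠ[nhds z] vBubble K (h + Real.sqrt (h ^ 2 + K)) a) :
    SolvesLiouvilleConst K h u := by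
  have hs := add_pos_of_solvable hc
  have hφ := phi_pos_of_solvable hc
  have hsq := phi_sq hs
  have hφK : 0 < (h + Real.sqrt (h ^ 2 + K)) ^ 2 + K := phi_sq_add_pos hc
  generalize h + Real.sqrt (h ^ 2 + K) = φ at *
  have ha2 : 0 < 1 - ‖a‖ ^ 2 := by nlinarith [norm_nonneg a]
  have hn : ‖a‖ ^ 2 = a.re * a.re + a.im * a.im := by
    rw [← Complex.normSq_eq_norm_sq, Complex.normSq_apply]
  have key := solves_of_eventuallyEq_log
    (fun z hz => bubble_quadratic_pos hφ hφK ha (mem_closedBall_zero_iff.1 hz))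
    (fun z hz => (hu z hz).trans (Eventually.of_forall (vBubble_eq K φ a)))
  convert key using 1
  · field_simp
    rw [hn]
    ring
  · field_simp
    linear_combination (‖a‖ ^ 2 - 1) * hsq

end Bubble

lemma exists_radialQuadratic_eq_sub_sqrt (A B C D : ℝ) :
    ∃ z ∈ Metric.closedBall (0 : ℂ) 1,
      radialQuadratic A B C D z = A + D - Real.sqrt (B ^ 2 + C ^ 2) := by
  have hnn : 0 ≤ B ^ 2 + C ^ 2 := by positivity
  set r := Real.sqrt (B ^ 2 + C ^ 2) with hr
  have hr2 : r ^ 2 = B ^ 2 + C ^ 2 := Real.sq_sqrt hnn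
  by_cases h0 : r = 0
  · have hB : B = 0 := by nlinarith [sq_nonneg B, sq_nonneg C]
    have hC : C = 0 := by nlinarith [sq_nonneg B, sq_nonneg C]
    exact ⟨1, by simp, by simp [radialQuadratic, hB, hC, h0]⟩
  · have hn : ‖(⟨-B / r, -C / r⟩ : ℂ)‖ ^ 2 = 1 := by
      rw [← Complex.normSq_eq_norm_sq, Complex.normSq_apply]
      field_simp
      linarith
    refine ⟨⟨-B / r, -C / r⟩, ?_, ?_⟩
    · rw [mem_closedBall_zero_iff]
      nlinarith [norm_nonneg (⟨-B / r, -C / r⟩ : ℂ)]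
    · rw [radialQuadratic, hn]
      field_simp
      linarith

lemma sqrt_lt_of_quadratic_pos {A B C D : ℝ}
    (hpos : ∀ z ∈ Metric.closedBall (0 : ℂ) 1, 0 < radialQuadratic A B C D z)
    (hK : 4 * A * D - B ^ 2 - C ^ 2 ≤ 0) :
    Real.sqrt (-(4 * A * D - B ^ 2 - C ^ 2)) < D - A := by
  obtain ⟨z₀, hz₀, hq₀⟩ := exists_radialQuadratic_eq_sub_sqrt A B C D
  have hT := hpos z₀ hz₀
  have hD : 0 < D := by simpa [radialQuadratic] using hpos 0 (by simp)
  rw [hq₀] at hT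
  have hr2 : Real.sqrt (B ^ 2 + C ^ 2) ^ 2 = B ^ 2 + C ^ 2 := Real.sq_sqrt (by positivity)
  have hr0 := Real.sqrt_nonneg (B ^ 2 + C ^ 2)
  set r := Real.sqrt (B ^ 2 + C ^ 2)
  have hh : 0 < D - A := by
    by_contra! hle
    have hA : 0 < A := by linarith
    have hn : ‖(⟨-B / (2 * A), -C / (2 * A)⟩ : ℂ)‖ ^ 2 = r ^ 2 / (2 * A) ^ 2 := by
      rw [← Complex.normSq_eq_norm_sq, Complex.normSq_apply, hr2]
      field_simp
    have hmem : (⟨-B / (2 * A), -C / (2 * A)⟩ : ℂ) ∈ Metric.closedBall (0 : ℂ) 1 := by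
      rw [mem_closedBall_zero_iff]
      have : ‖(⟨-B / (2 * A), -C / (2 * A)⟩ : ℂ)‖ = r / (2 * A) := by
        rw [← div_pow] at hn
        exact (sq_eq_sq₀ (norm_nonneg _) (by positivity)).1 hn
      rw [this, div_le_one (by positivity)]
      linarith
    have := hpos _ hmem
    rw [radialQuadratic, hn, hr2] at this
    have e : A * ((B ^ 2 + C ^ 2) / (2 * A) ^ 2) + B * (-B / (2 * A)) + C * (-C / (2 * A)) + D
        = (4 * A * D - B ^ 2 - C ^ 2) / (4 * A) := by
      field_simp
      ring
    simp only [e] at this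
    exact absurd this (not_lt.2 (div_nonpos_of_nonpos_of_nonneg hK (by positivity)))
  rw [Real.sqrt_lt' hh]
  nlinarith

lemma exists_bubble_center {A B C D s φ : ℝ} (hs : 0 < s) (hφ : 0 < φ) (hT : 0 < A + D)
    (hs2 : s ^ 2 = (D - A) ^ 2 + (4 * A * D - B ^ 2 - C ^ 2)) (hφs : φ = D - A + s) :
    ∃ a : ℂ, ‖a‖ < 1 ∧
      A = (φ ^ 2 * ‖a‖ ^ 2 + (4 * A * D - B ^ 2 - C ^ 2)) / (2 * φ * (1 - ‖a‖ ^ 2)) ∧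
      B = -2 * (φ ^ 2 + (4 * A * D - B ^ 2 - C ^ 2)) * a.re / (2 * φ * (1 - ‖a‖ ^ 2)) ∧
      C = -2 * (φ ^ 2 + (4 * A * D - B ^ 2 - C ^ 2)) * a.im / (2 * φ * (1 - ‖a‖ ^ 2)) ∧
      D = (φ ^ 2 + (4 * A * D - B ^ 2 - C ^ 2) * ‖a‖ ^ 2) / (2 * φ * (1 - ‖a‖ ^ 2)) := by
  obtain ⟨T, hTdef⟩ : ∃ T, T = A + D := ⟨_, rfl⟩
  have hT0 : 0 < T := hTdef ▸ hT
  have hTs : 0 < T + s := by positivity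
  have hn : ‖(⟨-B / (T + s), -C / (T + s)⟩ : ℂ)‖ ^ 2 = (T - s) / (T + s) := by
    rw [← Complex.normSq_eq_norm_sq, Complex.normSq_apply]
    field_simp
    rw [hTdef]
    linear_combination hs2
  have hn1 : 1 - (T - s) / (T + s) = 2 * s / (T + s) := by
    field_simp
    ring
  have hKφ : 4 * A * D - B ^ 2 - C ^ 2 = φ ^ 2 - 2 * (D - A) * φ := by
    rw [hφs]
    linear_combination -hs2
  have hφs' : φ ^ 2 + (φ ^ 2 - 2 * (D - A) * φ) = 2 * φ * s := by
    rw [hφs]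
    ring
  refine ⟨⟨-B / (T + s), -C / (T + s)⟩, ?_, ?_, ?_, ?_, ?_⟩
  · have : ‖(⟨-B / (T + s), -C / (T + s)⟩ : ℂ)‖ ^ 2 < 1 := by
      rw [hn, div_lt_one hTs]
      linarith
    nlinarith [norm_nonneg (⟨-B / (T + s), -C / (T + s)⟩ : ℂ)]
  · rw [hn, hn1, hKφ]
    field_simp
    rw [hTdef, hφs]
    ring
  · rw [hn, hn1, hKφ, hφs']
    field_simp
  · rw [hn, hn1, hKφ, hφs']
    field_simp
  · rw [hn, hn1, hKφ]
    field_simp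
    rw [hTdef, hφs]
    ring

lemma quadratic_of_solves {K h : ℝ} {v : ℂ → ℝ} (hv : ContDiff ℝ 2 v)
    (hs : SolvesLiouvilleConst K h v) :
    ∃ A B C D : ℝ, 4 * A * D - B ^ 2 - C ^ 2 = K ∧ D - A = h ∧
      (∀ z ∈ Metric.closedBall (0 : ℂ) 1, 0 < radialQuadratic A B C D z) ∧
      ∀ z ∈ Metric.closedBall (0 : ℂ) 1, v z = -2 * Real.log (radialQuadratic A B C D z) := by
  obtain ⟨A, B, C, D, hK, hh, hq⟩ := exists_quadratic_of_solves hv hs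
  refine ⟨A, B, C, D, hK, hh, fun z hz => ?_, fun z hz => ?_⟩
  · rw [radialQuadratic, ← hq z hz]
    exact Real.exp_pos _
  · rw [radialQuadratic, ← hq z hz, Real.log_exp]
    ring

/-- the constant-curvature problem is solvable iff `K₀ > 0`, or
`K₀ ≤ 0` and `h₀ > √(-K₀)`; in that case all solutions are exactly the bubbles
`v_a`, `a ∈ 𝔻`, with `φ₀ = h₀ + √(h₀² + K₀)`. -/
theorem constant_curvature_classification (K₀ h₀ : ℝ) :
    ((∃ v : ℂ → ℝ, ContDiff ℝ 2 v ∧ SolvesLiouvilleConst K₀ h₀ v) ↔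
      (0 < K₀ ∨ (K₀ ≤ 0 ∧ Real.sqrt (-K₀) < h₀))) ∧
    ((0 < K₀ ∨ (K₀ ≤ 0 ∧ Real.sqrt (-K₀) < h₀)) →
      (∀ v : ℂ → ℝ, ContDiff ℝ 2 v → SolvesLiouvilleConst K₀ h₀ v →
          ∃ a ∈ unitDisk, ∀ z ∈ unitClosedDisk,
            v z = vBubble K₀ (h₀ + Real.sqrt (h₀ ^ 2 + K₀)) a z) ∧
      (∀ a ∈ unitDisk,
          SolvesLiouvilleConst K₀ h₀ (vBubble K₀ (h₀ + Real.sqrt (h₀ ^ 2 + K₀)) a))) := by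
  refine ⟨⟨?_, fun hc => ?_⟩, fun hc => ⟨fun v hv hs => ?_, fun a ha => ?_⟩⟩
  · rintro ⟨v, hv, hs⟩
    obtain ⟨A, B, C, D, hK, hh, hpos, -⟩ := quadratic_of_solves hv hs
    subst hK hh
    rcases lt_or_ge 0 (4 * A * D - B ^ 2 - C ^ 2) with h | h
    · exact Or.inl h
    · exact Or.inr ⟨h, sqrt_lt_of_quadratic_pos hpos h⟩
  · have hφ := phi_pos_of_solvable hc
    have hφK : 0 < (h₀ + Real.sqrt (h₀ ^ 2 + K₀)) ^ 2 + K₀ :=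
      phi_sq_add_pos hc
    obtain ⟨Q, hQ, hQ0, hQP⟩ := exists_contDiff_pos_extension (contDiff_radialQuadratic _ _ _ _)
      (fun z hz => bubble_quadratic_pos (a := 0) hφ hφK (by simp) (mem_closedBall_zero_iff.1 hz))
    refine ⟨fun z => -2 * Real.log (Q z), contDiff_const.mul (hQ.log fun z => (hQ0 z).ne'),
      solves_of_eventuallyEq_vBubble hc (a := 0) (by simp) fun z hz => ?_⟩
    filter_upwards [hQP z hz] with x hx
    rw [hx, vBubble_eq]
  · obtain ⟨A, B, C, D, hK, hh, hpos, hq⟩ := quadratic_of_solves hv hs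
    subst hK hh
    have hT : 0 < A + D := by
      have h1 := hpos 1 (by simp)
      have h2 := hpos (-1) (by simp)
      simp [radialQuadratic] at h1 h2
      linarith
    have hsp := add_pos_of_solvable hc
    obtain ⟨a, ha, hA, hB, hC, hD⟩ := exists_bubble_center (Real.sqrt_pos.2 hsp)
      (phi_pos_of_solvable hc) hT (Real.sq_sqrt hsp.le) rfl
    refine ⟨a, mem_ball_zero_iff.2 ha, fun z hz => ?_⟩
    rw [hq z hz, vBubble_eq, ← hA, ← hB, ← hC, ← hD]
  · exact solves_of_eventuallyEq_vBubble hc (mem_ball_zero_iff.1 ha) fun _ _ => EventuallyEq.rfl
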